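/- arXiv:2309.00574 — 2 statements merged into one kernel-verified Lean document; each statement's English description precedes it below -/
import Mathlib

section
/- Let 0 < p < 1 and, for a global weak solution u, set E(r) = ∫_{Q_r^κ} f(|u|) dx dt. For every κ > 0 there exist constants C > 0 and σ > 0, depending only on A, k, m, n, p and κ, such that for every global weak solution u of the problem and all R > 0 at least one of the following two systems of inequalities holds. System (I): (mes(Q_R^κ \ Q_{R/2}^κ))^{−1} ∫_{Q_R^κ \ Q_{R/2}^κ} |u| dx dt ≥ σ R^{−(n−(k−1)κ)} E(R/2) and E(R) − E(R/2) ≥ C R^{n+κ} f( σ E(R/2) / R^{n−(k−1)κ} ). System (II): ( (mes(Q_R^κ \ Q_{R/2}^κ))^{−1} ∫_{Q_R^κ \ Q_{R/2}^κ} |u| dx dt )^p ≥ σ R^{−(n+κ−m)} E(R/2) and E(R) − E(R/2) ≥ C R^{n+κ} f( ( σ E(R/2) / R^{n+κ−m} )^{1/p} ). -/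
open MeasureTheory Real Set Filter

noncomputable section

/-- The spatial domain `ℝⁿ`. -/
abbrev Spc (n : ℕ) := EuclideanSpace ℝ (Fin n)

/-- The open ball `B_r` in `ℝⁿ` of radius `r` centered at `0`. -/
def ball0 (n : ℕ) (r : ℝ) : Set (Spc n) := Metric.ball 0 r

/-- The cylinder `Q_r^κ = B_r × (0, r^κ)`. -/
def cyl (n : ℕ) (r κ : ℝ) : Set (Spc n × ℝ) := ball0 n r ×ˢ Ioo 0 (r ^ κ)

/-- The half-space `ℝ^{n+1}_+ = ℝⁿ × (0, ∞)`. -/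
def halfSp (n : ℕ) : Set (Spc n × ℝ) := {z | 0 < z.2}

/-- The (finite) set of multi-indices `α` with `|α| = m`. -/
def mIdx (n m : ℕ) : Finset (Fin n → ℕ) :=
  (Fintype.piFinset fun _ : Fin n => Finset.range (m + 1)).filter fun α => ∑ i, α i = m

/-- Spatial partial derivative `∂/∂x_i`. -/
def spDeriv (n : ℕ) (i : Fin n) (φ : Spc n × ℝ → ℝ) : Spc n × ℝ → ℝ :=
  fun z => deriv (fun s : ℝ => φ (z.1 + s • EuclideanSpace.single i (1 : ℝ), z.2)) 0

/-- Time derivative `∂/∂t`. -/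
def tDeriv (n : ℕ) (φ : Spc n × ℝ → ℝ) : Spc n × ℝ → ℝ :=
  fun z => deriv (fun s : ℝ => φ (z.1, s)) z.2

/-- Multi-index spatial derivative `∂^α`. -/
def mDeriv (n : ℕ) (α : Fin n → ℕ) (φ : Spc n × ℝ → ℝ) : Spc n × ℝ → ℝ :=
  (List.finRange n).foldr (fun i ψ => (spDeriv n i)^[α i] ψ) φ

/-- Caratheodory conditions and the growth bound `|a_α(x,t,ζ)| ≤ A |ζ|^p` for the
coefficients of the operator `L`. -/
def GoodCoeffs (n m : ℕ) (A p : ℝ) (a : (Fin n → ℕ) → Spc n × ℝ → ℝ → ℝ) : Prop :=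
  ∀ α ∈ mIdx n m,
    (∀ ζ : ℝ, Measurable fun z => a α z ζ) ∧
    (∀ᵐ z ∂(volume.restrict (halfSp n)), Continuous fun ζ => a α z ζ) ∧
    (∀ᵐ z ∂(volume.restrict (halfSp n)), ∀ ζ : ℝ, |a α z ζ| ≤ A * |ζ| ^ p)

/-- The standing conditions on `f`: `ζ ↦ f ζ` and `ζ ↦ f (ζ^{1/p})` are nondecreasing
and convex on `[0,∞)`, and `f` is positive on `(0,∞)`. -/
def GoodF (p : ℝ) (f : ℝ → ℝ) : Prop :=
  MonotoneOn f (Ici 0) ∧ ConvexOn ℝ (Ici 0) f ∧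
  MonotoneOn (fun ζ => f (ζ ^ (1 / p))) (Ici 0) ∧
  ConvexOn ℝ (Ici 0) (fun ζ => f (ζ ^ (1 / p))) ∧
  ∀ ζ : ℝ, 0 < ζ → 0 < f ζ

/-- Condition (1.4): `∫_1^∞ ζ^{1/k - 1} f(ζ)^{-1/k} dζ < ∞`. -/
def Cond14 (k : ℕ) (f : ℝ → ℝ) : Prop :=
  IntegrableOn (fun ζ : ℝ => ζ ^ ((k : ℝ)⁻¹ - 1) / f ζ ^ ((k : ℝ)⁻¹)) (Ioi 1)

/-- Condition (1.5): `∫_1^∞ ζ^{p/m - 1} f(ζ)^{-1/m} dζ < ∞`. -/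
def Cond15 (m : ℕ) (p : ℝ) (f : ℝ → ℝ) : Prop :=
  IntegrableOn (fun ζ : ℝ => ζ ^ (p / (m : ℝ) - 1) / f ζ ^ ((m : ℝ)⁻¹)) (Ioi 1)

/-- `v ∈ L^1_loc(ℝⁿ)`. -/
def L1locInit (n : ℕ) (v : Spc n → ℝ) : Prop :=
  ∀ r : ℝ, 0 < r → IntegrableOn v (ball0 n r)

/-- `u` is a global weak solution of
`∂_t^k u - Σ_{|α| = m} ∂^α a_α(x,t,u) ≥ f(|u|)` in `ℝ^{n+1}_+`, with initial data
`∂_t^i u(·,0) = u0 i` for `0 ≤ i ≤ k-1`. -/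
def IsGlobalWeakSol (n k m : ℕ) (p : ℝ) (a : (Fin n → ℕ) → Spc n × ℝ → ℝ → ℝ)
    (f : ℝ → ℝ) (u0 : ℕ → Spc n → ℝ) (u : Spc n × ℝ → ℝ) : Prop :=
  (∀ r : ℝ, 0 < r → IntegrableOn u (cyl n r 1)) ∧
  (∀ r : ℝ, 0 < r → IntegrableOn (fun z => |u z| ^ p) (cyl n r 1)) ∧
  (∀ r : ℝ, 0 < r → IntegrableOn (fun z => f |u z|) (cyl n r 1)) ∧
  ∀ φ : Spc n × ℝ → ℝ, ContDiff ℝ (⊤ : ℕ∞) φ → HasCompactSupport φ →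
    (∀ z, 0 ≤ φ z) →
    (∫ z in halfSp n, (-1 : ℝ) ^ k * u z * (tDeriv n)^[k] φ z)
      - (∫ z in halfSp n, ∑ α ∈ mIdx n m, (-1 : ℝ) ^ m * a α z (u z) * mDeriv n α φ z)
    ≥ (∫ x : Spc n, ∑ i ∈ Finset.range k,
          (-1 : ℝ) ^ i * u0 (k - 1 - i) x * (tDeriv n)^[i] φ (x, 0))
      + ∫ z in halfSp n, f |u z| * φ z

/-- `u = 0` almost everywhere in `ℝ^{n+1}_+`. -/
def TrivialSol (n : ℕ) (u : Spc n × ℝ → ℝ) : Prop :=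
  ∀ᵐ z ∂(volume.restrict (halfSp n)), u z = 0

/-- The standing hypotheses of Section 3: the coefficients are Caratheodory functions
with the growth bound, `f` satisfies the monotonicity/convexity/positivity conditions
together with (1.4) and (1.5), and the initial data are locally integrable with
`u_{k-1} ≥ 0` a.e. -/
def Standing (n k m : ℕ) (A p : ℝ) (a : (Fin n → ℕ) → Spc n × ℝ → ℝ → ℝ)
    (f : ℝ → ℝ) (u0 : ℕ → Spc n → ℝ) : Prop :=
  GoodCoeffs n m A p a ∧ GoodF p f ∧
  (∀ i < k, L1locInit n (u0 i)) ∧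
  (∀ᵐ x ∂(volume : Measure (Spc n)), 0 ≤ u0 (k - 1) x) ∧
  Cond14 k f ∧ Cond15 m p f

/-! ### Derivatives of locally constant, smooth and rescaled functions -/

section Derivatives

variable {n : ℕ} {φ : Spc n × ℝ → ℝ}

theorem tDeriv_eq_zero_of_const {U : Set (Spc n × ℝ)} (hU : IsOpen U) {c : ℝ}
    (h : ∀ z ∈ U, φ z = c) : ∀ z ∈ U, tDeriv n φ z = 0 := by
  intro z hz
  have hcont : Continuous fun s : ℝ => (z.1, s) := by fun_prop
  have hev : (fun s : ℝ => φ (z.1, s)) =ᶠ[nhds z.2] fun _ => c := by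
    filter_upwards [hcont.continuousAt.preimage_mem_nhds (hU.mem_nhds hz)] with s hs
    exact h _ hs
  simp [tDeriv, hev.deriv_eq]

theorem spDeriv_eq_zero_of_const {U : Set (Spc n × ℝ)} (hU : IsOpen U) {c : ℝ}
    (h : ∀ z ∈ U, φ z = c) (i : Fin n) : ∀ z ∈ U, spDeriv n i φ z = 0 := by
  intro z hz
  have hcont : Continuous fun s : ℝ =>
      (z.1 + s • EuclideanSpace.single i (1 : ℝ), z.2) := by fun_prop
  have hev : (fun s : ℝ => φ (z.1 + s • EuclideanSpace.single i (1 : ℝ), z.2))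
      =ᶠ[nhds 0] fun _ => c := by
    filter_upwards [hcont.continuousAt.preimage_mem_nhds (hU.mem_nhds (by simpa using hz))]
      with s hs
    exact h _ hs
  simp [spDeriv, hev.deriv_eq]

theorem iterate_tDeriv_eq_zero {U : Set (Spc n × ℝ)} (hU : IsOpen U)
    (h : ∀ z ∈ U, φ z = 0) (j : ℕ) : ∀ z ∈ U, (tDeriv n)^[j] φ z = 0 := by
  induction j with
  | zero => simpa using h
  | succ j ih =>
    rw [Function.iterate_succ_apply']
    exact tDeriv_eq_zero_of_const hU ih

theorem iterate_tDeriv_eq_zero_of_const {U : Set (Spc n × ℝ)} (hU : IsOpen U) {c : ℝ}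
    (h : ∀ z ∈ U, φ z = c) {j : ℕ} (hj : 1 ≤ j) : ∀ z ∈ U, (tDeriv n)^[j] φ z = 0 := by
  obtain ⟨j, rfl⟩ := Nat.exists_eq_add_of_le' hj
  rw [Function.iterate_succ_apply]
  exact iterate_tDeriv_eq_zero hU (tDeriv_eq_zero_of_const hU h) j

theorem iterate_spDeriv_const {U : Set (Spc n × ℝ)} (hU : IsOpen U)
    (h : ∃ c, ∀ z ∈ U, φ z = c) (i : Fin n) (j : ℕ) :
    ∃ c, ∀ z ∈ U, (spDeriv n i)^[j] φ z = c := by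
  induction j with
  | zero => simpa using h
  | succ j ih =>
    rw [Function.iterate_succ_apply']
    obtain ⟨c, hc⟩ := ih
    exact ⟨0, spDeriv_eq_zero_of_const hU hc i⟩

theorem foldr_spDeriv_const {U : Set (Spc n × ℝ)} (hU : IsOpen U)
    (h : ∃ c, ∀ z ∈ U, φ z = c) (α : Fin n → ℕ) (l : List (Fin n)) :
    ∃ c, ∀ z ∈ U, l.foldr (fun i ψ => (spDeriv n i)^[α i] ψ) φ z = c := by
  induction l with
  | nil => simpa using h
  | cons i l ih => exact iterate_spDeriv_const hU ih i (α i)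

theorem foldr_spDeriv_eq_zero_of_const {U : Set (Spc n × ℝ)} (hU : IsOpen U)
    (h : ∃ c, ∀ z ∈ U, φ z = c) (α : Fin n → ℕ) (l : List (Fin n))
    (hα : ∃ i ∈ l, α i ≠ 0) :
    ∀ z ∈ U, l.foldr (fun i ψ => (spDeriv n i)^[α i] ψ) φ z = 0 := by
  induction l with
  | nil => simp at hα
  | cons i l ih =>
    rw [List.foldr_cons]
    rcases hi : α i with _ | j
    · obtain ⟨i', hi', h'⟩ := hα
      rcases List.mem_cons.1 hi' with rfl | hi'
      · exact absurd hi h'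
      · simpa using ih ⟨i', hi', h'⟩
    · rw [Function.iterate_succ_apply']
      obtain ⟨c, hc⟩ := iterate_spDeriv_const hU (foldr_spDeriv_const hU h α l) i j
      exact spDeriv_eq_zero_of_const hU hc i

theorem exists_ne_zero_of_mem_mIdx {m : ℕ} (hm : 1 ≤ m) {α : Fin n → ℕ} (hα : α ∈ mIdx n m) :
    ∃ i, α i ≠ 0 := by
  by_contra! h
  have := (Finset.mem_filter.1 hα).2
  simp [h] at this
  omega

theorem mDeriv_eq_zero_of_const {m : ℕ} (hm : 1 ≤ m) {α : Fin n → ℕ} (hα : α ∈ mIdx n m)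
    {U : Set (Spc n × ℝ)} (hU : IsOpen U) {c : ℝ} (h : ∀ z ∈ U, φ z = c) :
    ∀ z ∈ U, mDeriv n α φ z = 0 := by
  obtain ⟨i, hi⟩ := exists_ne_zero_of_mem_mIdx hm hα
  exact foldr_spDeriv_eq_zero_of_const hU ⟨c, h⟩ α _ ⟨i, List.mem_finRange i, hi⟩

theorem contDiff_tDeriv (h : ContDiff ℝ (⊤ : ℕ∞) φ) : ContDiff ℝ (⊤ : ℕ∞) (tDeriv n φ) := by
  have heq : tDeriv n φ = fun z => fderiv ℝ φ z (0, 1) := by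
    ext z
    have h1 : HasFDerivAt φ (fderiv ℝ φ z) (z.1, z.2) :=
      (h.differentiable (by simp) z).hasFDerivAt
    have h2 : HasDerivAt (fun s : ℝ => (z.1, s)) ((0 : Spc n), (1 : ℝ)) z.2 :=
      (hasDerivAt_const _ _).prodMk (hasDerivAt_id _)
    exact (h1.comp_hasDerivAt z.2 h2).deriv
  rw [heq]
  exact (h.fderiv_right (by simp)).clm_apply contDiff_const

theorem contDiff_spDeriv (h : ContDiff ℝ (⊤ : ℕ∞) φ) (i : Fin n) :
    ContDiff ℝ (⊤ : ℕ∞) (spDeriv n i φ) := by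
  have heq : spDeriv n i φ = fun z => fderiv ℝ φ z (EuclideanSpace.single i (1 : ℝ), 0) := by
    ext z
    have h1 : HasFDerivAt φ (fderiv ℝ φ z)
        (z.1 + (0 : ℝ) • EuclideanSpace.single i (1 : ℝ), z.2) := by
      simpa using (h.differentiable (by simp) z).hasFDerivAt
    have h2 : HasDerivAt (fun s : ℝ => (z.1 + s • EuclideanSpace.single i (1 : ℝ), z.2))
        (EuclideanSpace.single i (1 : ℝ), (0 : ℝ)) 0 := by
      refine HasDerivAt.prodMk ?_ (hasDerivAt_const _ _)
      simpa using ((hasDerivAt_id (0 : ℝ)).smul_const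
        (EuclideanSpace.single i (1 : ℝ))).const_add z.1
    exact (h1.comp_hasDerivAt 0 h2).deriv
  rw [heq]
  exact (h.fderiv_right (by simp)).clm_apply contDiff_const

theorem contDiff_iterate_tDeriv (h : ContDiff ℝ (⊤ : ℕ∞) φ) (j : ℕ) :
    ContDiff ℝ (⊤ : ℕ∞) ((tDeriv n)^[j] φ) := by
  induction j with
  | zero => exact h
  | succ j ih =>
    rw [Function.iterate_succ_apply']
    exact contDiff_tDeriv ih

theorem contDiff_mDeriv (h : ContDiff ℝ (⊤ : ℕ∞) φ) (α : Fin n → ℕ) :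
    ContDiff ℝ (⊤ : ℕ∞) (mDeriv n α φ) := by
  have hiter : ∀ (i : Fin n) (j : ℕ) (ψ : Spc n × ℝ → ℝ), ContDiff ℝ (⊤ : ℕ∞) ψ →
      ContDiff ℝ (⊤ : ℕ∞) ((spDeriv n i)^[j] ψ) := by
    intro i j ψ hψ
    induction j with
    | zero => exact hψ
    | succ j ih =>
      rw [Function.iterate_succ_apply']
      exact contDiff_spDeriv ih i
  unfold mDeriv
  induction List.finRange n with
  | nil => exact h
  | cons i l ih => exact hiter i _ _ ih

theorem iterate_tDeriv_scale (a b : ℝ) (j : ℕ) :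
    (tDeriv n)^[j] (fun z => φ (a • z.1, b * z.2))
      = fun z => b ^ j * (tDeriv n)^[j] φ (a • z.1, b * z.2) := by
  induction j with
  | zero => simp
  | succ j ih =>
    rw [Function.iterate_succ_apply', ih]
    ext z
    rw [Function.iterate_succ_apply']
    simp only [tDeriv, deriv_const_mul_field]
    rw [deriv_comp_mul_left b (fun s => (tDeriv n)^[j] φ (a • z.1, s)) z.2]
    simp only [smul_eq_mul]
    ring

theorem iterate_spDeriv_scale (a b c : ℝ) (i : Fin n) (j : ℕ) :
    (spDeriv n i)^[j] (fun z => c * φ (a • z.1, b * z.2))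
      = fun z => c * a ^ j * (spDeriv n i)^[j] φ (a • z.1, b * z.2) := by
  induction j with
  | zero => simp
  | succ j ih =>
    rw [Function.iterate_succ_apply', ih]
    ext z
    rw [Function.iterate_succ_apply']
    simp only [spDeriv, deriv_const_mul_field, smul_add, smul_smul]
    rw [deriv_comp_mul_left a (fun s => (spDeriv n i)^[j] φ
      (a • z.1 + s • EuclideanSpace.single i (1 : ℝ), b * z.2)) 0]
    simp only [smul_eq_mul, mul_zero]
    ring

theorem mDeriv_scale {m : ℕ} {α : Fin n → ℕ} (hα : α ∈ mIdx n m) (a b : ℝ) :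
    mDeriv n α (fun z => φ (a • z.1, b * z.2))
      = fun z => a ^ m * mDeriv n α φ (a • z.1, b * z.2) := by
  have key : ∀ l : List (Fin n),
      l.foldr (fun i ψ => (spDeriv n i)^[α i] ψ) (fun z => φ (a • z.1, b * z.2))
        = fun z => a ^ (l.map α).sum
          * l.foldr (fun i ψ => (spDeriv n i)^[α i] ψ) φ (a • z.1, b * z.2) := by
    intro l
    induction l with
    | nil => simp
    | cons i l ih =>
      rw [List.foldr_cons, ih, iterate_spDeriv_scale]
      ext z
      simp only [List.map_cons, List.sum_cons, List.foldr_cons]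
      ring
  rw [← (Finset.mem_filter.1 hα).2, Fin.sum_univ_def]
  exact key _

end Derivatives

/-! ### The cutoff function -/

theorem mem_cyl_scale {n : ℕ} {R κ : ℝ} (hR : 0 < R) {r : ℝ} (hr : 0 ≤ r) (z : Spc n × ℝ) :
    (R⁻¹ • z.1, (R ^ κ)⁻¹ * z.2) ∈ cyl n r κ ↔ z ∈ cyl n (R * r) κ := by
  have hRκ : 0 < R ^ κ := rpow_pos_of_pos hR κ
  simp only [cyl, ball0, mem_prod, mem_ball_zero_iff, mem_Ioo, norm_smul, norm_inv,
    Real.norm_eq_abs, abs_of_pos hR, inv_mul_lt_iff₀ hR, inv_mul_lt_iff₀ hRκ,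
    mul_rpow hR.le hr]
  rw [mul_pos_iff_of_pos_left (inv_pos.2 hRκ)]

theorem exists_cutoff (n k m : ℕ) (hk : 1 ≤ k) (hm : 1 ≤ m) {κ : ℝ} (hκ : 0 < κ) :
    ∃ (ψ : Spc n × ℝ → ℝ) (M N : ℝ), ContDiff ℝ (⊤ : ℕ∞) ψ ∧ HasCompactSupport ψ ∧
      (∀ z, 0 ≤ ψ z) ∧ (∀ z, ψ z ≤ 1) ∧ (∀ z ∈ cyl n (1 / 2) κ, ψ z = 1) ∧
      (∀ z ∈ halfSp n, z ∉ cyl n 1 κ → ψ z = 0) ∧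
      (∀ i, 1 ≤ i → ∀ x, (tDeriv n)^[i] ψ (x, 0) = 0) ∧
      0 ≤ M ∧ 0 ≤ N ∧
      (∀ z, |(tDeriv n)^[k] ψ z| ≤ M) ∧
      (∀ z, ∑ α ∈ mIdx n m, |mDeriv n α ψ z| ≤ N) ∧
      (∀ z ∈ halfSp n, z ∉ cyl n 1 κ \ cyl n (1 / 2) κ → (tDeriv n)^[k] ψ z = 0 ∧
        ∀ α ∈ mIdx n m, mDeriv n α ψ z = 0) := by
  set τ : ℝ := (1 / 2) ^ κ
  have hτ0 : 0 < τ := by positivity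
  have hτ1 : τ < 1 := rpow_lt_one (by norm_num) (by norm_num) hκ
  let g : ContDiffBump (0 : Spc n) := ⟨1 / 2, 3 / 4, by norm_num, by norm_num⟩
  let h : ContDiffBump (0 : ℝ) := ⟨τ, (1 + τ) / 2, hτ0, by linarith⟩
  let ψ : Spc n × ℝ → ℝ := fun z => g z.1 * h z.2
  set K : Set (Spc n × ℝ) := Metric.closedBall 0 (3 / 4) ×ˢ Metric.closedBall 0 ((1 + τ) / 2)
  have hKc : IsCompact K := (isCompact_closedBall _ _).prod (isCompact_closedBall _ _)
  have hKo : IsOpen Kᶜ := hKc.isClosed.isOpen_compl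
  have hsm : ContDiff ℝ (⊤ : ℕ∞) ψ := (g.contDiff.comp contDiff_fst).mul
    (h.contDiff.comp contDiff_snd)
  have hψK : ∀ z ∈ Kᶜ, ψ z = 0 := by
    intro z hz
    by_cases h1 : z.1 ∈ Metric.closedBall (0 : Spc n) (3 / 4)
    · have h2 : z.2 ∉ Metric.closedBall (0 : ℝ) ((1 + τ) / 2) := fun h2 => hz ⟨h1, h2⟩
      have : h z.2 = 0 := h.zero_of_le_dist (le_of_lt (by simpa using h2))
      simp [ψ, this]
    · have : g z.1 = 0 := g.zero_of_le_dist (le_of_lt (by simpa using h1))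
      simp [ψ, this]
  set V : Set (Spc n × ℝ) := Metric.ball 0 (1 / 2) ×ˢ Metric.ball 0 τ
  have hVo : IsOpen V := Metric.isOpen_ball.prod Metric.isOpen_ball
  have hψV : ∀ z ∈ V, ψ z = 1 := by
    intro z hz
    have h1 : g z.1 = 1 := g.one_of_mem_closedBall (Metric.ball_subset_closedBall hz.1)
    have h2 : h z.2 = 1 := h.one_of_mem_closedBall (Metric.ball_subset_closedBall hz.2)
    simp [ψ, h1, h2]
  have hcylV : cyl n (1 / 2) κ ⊆ V := by
    rintro z ⟨h1, h2⟩
    refine ⟨h1, ?_⟩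
    rw [mem_ball_zero_iff, Real.norm_eq_abs, abs_of_pos h2.1]
    exact h2.2
  have hcylK : ∀ z ∈ halfSp n, z ∉ cyl n 1 κ → z ∈ Kᶜ := by
    intro z hz hz1 hzK
    refine hz1 ⟨?_, hz, ?_⟩
    · have := mem_closedBall_zero_iff.1 hzK.1
      rw [ball0, mem_ball_zero_iff]
      linarith
    · have := mem_closedBall_zero_iff.1 hzK.2
      rw [Real.norm_eq_abs] at this
      rw [one_rpow]
      linarith [le_abs_self z.2]
  have hbdd : ∀ χ : Spc n × ℝ → ℝ, ContDiff ℝ (⊤ : ℕ∞) χ → (∀ z ∈ Kᶜ, χ z = 0) →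
      ∃ M, ∀ z, |χ z| ≤ M := by
    intro χ h1 h2
    exact (HasCompactSupport.intro hKc h2).exists_bound_of_continuous h1.continuous
  obtain ⟨M, hM⟩ := hbdd _ (contDiff_iterate_tDeriv hsm k) (iterate_tDeriv_eq_zero hKo hψK k)
  have hN : ∀ α ∈ mIdx n m, ∃ N, ∀ z, |mDeriv n α ψ z| ≤ N := fun α hα =>
    hbdd _ (contDiff_mDeriv hsm α) (mDeriv_eq_zero_of_const hm hα hKo hψK)
  choose! N hN using hN
  have hN' : ∀ z, ∑ α ∈ mIdx n m, |mDeriv n α ψ z| ≤ ∑ α ∈ mIdx n m, N α :=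
    fun z => Finset.sum_le_sum fun α hα => hN α hα z
  refine ⟨ψ, M, ∑ α ∈ mIdx n m, N α, hsm, HasCompactSupport.intro hKc hψK,
    fun z => mul_nonneg g.nonneg h.nonneg,
    fun z => mul_le_one₀ g.le_one h.nonneg h.le_one,
    fun z hz => hψV z (hcylV hz), fun z hz hz1 => hψK z (hcylK z hz hz1), ?_,
    (abs_nonneg _).trans (hM 0), (Finset.sum_nonneg fun _ _ => abs_nonneg _).trans (hN' 0),
    hM, hN', ?_⟩
  · intro i hi x
    obtain ⟨i, rfl⟩ := Nat.exists_eq_add_of_le' hi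
    rw [Function.iterate_succ_apply]
    have hWo : IsOpen ((univ : Set (Spc n)) ×ˢ Metric.ball (0 : ℝ) τ) :=
      isOpen_univ.prod Metric.isOpen_ball
    refine iterate_tDeriv_eq_zero hWo (fun z hz => ?_) i (x, 0) ⟨mem_univ _, by simpa using hτ0⟩
    have hev : (fun s : ℝ => ψ (z.1, s)) =ᶠ[nhds z.2] fun _ => g z.1 := by
      filter_upwards [Metric.isOpen_ball.mem_nhds hz.2] with s hs
      simp [ψ, h.one_of_mem_closedBall (Metric.ball_subset_closedBall hs)]
    simp [tDeriv, hev.deriv_eq]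
  · intro z hz hzD
    by_cases hz1 : z ∈ cyl n 1 κ
    · have hzV : z ∈ V := hcylV (by by_contra h'; exact hzD ⟨hz1, h'⟩)
      exact ⟨iterate_tDeriv_eq_zero_of_const hVo hψV hk z hzV,
        fun α hα => mDeriv_eq_zero_of_const hm hα hVo hψV z hzV⟩
    · have hzK := hcylK z hz hz1
      exact ⟨iterate_tDeriv_eq_zero_of_const hKo hψK hk z hzK,
        fun α hα => mDeriv_eq_zero_of_const hm hα hKo hψK z hzK⟩

/-! ### Geometry of the cylinders -/

section Cylinders

variable {n : ℕ} {κ : ℝ}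

theorem measurableSet_cyl (r : ℝ) : MeasurableSet (cyl n r κ) :=
  measurableSet_ball.prod measurableSet_Ioo

theorem measurableSet_halfSp : MeasurableSet (halfSp n) :=
  measurableSet_lt measurable_const measurable_snd

theorem cyl_subset_halfSp (r : ℝ) : cyl n r κ ⊆ halfSp n := fun _ hz => hz.2.1

theorem cyl_mono (hκ : 0 < κ) {r s : ℝ} (hr : 0 ≤ r) (hrs : r ≤ s) : cyl n r κ ⊆ cyl n s κ :=
  prod_mono (Metric.ball_subset_ball hrs)
    (Ioo_subset_Ioo_right (rpow_le_rpow hr hrs hκ.le))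

theorem cyl_subset_cyl_one (r : ℝ) : cyl n r κ ⊆ cyl n (max r (r ^ κ)) 1 :=
  prod_mono (Metric.ball_subset_ball (le_max_left _ _))
    (Ioo_subset_Ioo_right (by rw [rpow_one]; exact le_max_right _ _))

theorem integrableOn_cyl {g : Spc n × ℝ → ℝ} (h : ∀ r : ℝ, 0 < r → IntegrableOn g (cyl n r 1))
    {R : ℝ} (hR : 0 < R) : IntegrableOn g (cyl n R κ) :=
  (h _ (lt_max_of_lt_left hR)).mono_set (cyl_subset_cyl_one R)

theorem volume_cyl {r : ℝ} (hr : 0 < r) :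
    volume (cyl n r κ)
      = ENNReal.ofReal (r ^ ((n : ℝ) + κ)) * volume (Metric.ball (0 : Spc n) 1) := by
  rw [cyl, ball0, Measure.volume_eq_prod, Measure.prod_prod, Measure.addHaar_ball_of_pos _ _ hr,
    finrank_euclideanSpace_fin, Real.volume_Ioo, sub_zero, mul_right_comm,
    ← ENNReal.ofReal_mul (by positivity), rpow_add hr, rpow_natCast]

theorem volume_cyl_ne_top {r : ℝ} (hr : 0 < r) : volume (cyl n r κ) ≠ ⊤ := by
  rw [volume_cyl hr]
  exact ENNReal.mul_ne_top ENNReal.ofReal_ne_top measure_ball_lt_top.ne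

/-- The shells `Q_R^κ \ Q_{R/2}^κ` have measure proportional to `R^{n+κ}`. -/
theorem exists_volume_shell (n : ℕ) {κ : ℝ} (hκ : 0 < κ) :
    ∃ c : ℝ, 0 < c ∧ ∀ R : ℝ, 0 < R →
      (volume (cyl n R κ \ cyl n (R / 2) κ)).toReal = c * R ^ ((n : ℝ) + κ) := by
  have hω : 0 < (volume (Metric.ball (0 : Spc n) 1)).toReal :=
    ENNReal.toReal_pos (Metric.measure_ball_pos _ _ one_pos).ne' measure_ball_lt_top.ne
  have hlt : (1 / 2 : ℝ) ^ ((n : ℝ) + κ) < 1 :=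
    rpow_lt_one (by norm_num) (by norm_num) (by positivity)
  refine ⟨(1 - (1 / 2) ^ ((n : ℝ) + κ)) * (volume (Metric.ball (0 : Spc n) 1)).toReal,
    mul_pos (by linarith) hω, fun R hR => ?_⟩
  have hsub : cyl n (R / 2) κ ⊆ cyl n R κ := cyl_mono hκ (by positivity) (by linarith)
  rw [measure_sdiff hsub (measurableSet_cyl _).nullMeasurableSet
      (volume_cyl_ne_top (by positivity)),
    ENNReal.toReal_sub_of_le (measure_mono hsub) (volume_cyl_ne_top hR), volume_cyl hR,
    volume_cyl (half_pos hR), ENNReal.toReal_mul, ENNReal.toReal_mul,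
    ENNReal.toReal_ofReal (by positivity), ENNReal.toReal_ofReal (by positivity),
    div_eq_mul_one_div R 2, mul_rpow hR.le (by norm_num)]
  ring

end Cylinders

/-! ### Properties of the nonlinearity -/

theorem continuousOn_Ici_of_convexOn_of_monotoneOn {f : ℝ → ℝ} (hc : ConvexOn ℝ (Ici 0) f)
    (hm : MonotoneOn f (Ici 0)) : ContinuousOn f (Ici 0) := by
  intro x hx
  rcases (mem_Ici.1 hx).eq_or_lt with rfl | hx
  · have hlim : Tendsto (fun y : ℝ => (1 - y) * f 0 + y * f 1) (nhdsWithin 0 (Ici 0))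
        (nhds (f 0)) := by
      have : Continuous fun y : ℝ => (1 - y) * f 0 + y * f 1 := by fun_prop
      simpa using (this.tendsto 0).mono_left nhdsWithin_le_nhds
    refine tendsto_of_tendsto_of_tendsto_of_le_of_le' tendsto_const_nhds hlim ?_ ?_
    · filter_upwards [self_mem_nhdsWithin] with y hy
      exact hm self_mem_Ici hy hy
    · filter_upwards [self_mem_nhdsWithin, mem_nhdsWithin_of_mem_nhds (Iio_mem_nhds one_pos)]
        with y hy hy1
      have := hc.2 (x := 0) (y := 1) self_mem_Ici (mem_Ici.2 zero_le_one)
        (sub_nonneg.2 (le_of_lt hy1)) (mem_Ici.1 hy) (by ring)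
      simpa using this
  · have hint := hc.continuousOn_interior
    rw [interior_Ici] at hint
    exact (hint.continuousAt (Ioi_mem_nhds hx)).continuousWithinAt

theorem GoodF.nonneg {p : ℝ} {f : ℝ → ℝ} (hf : GoodF p f) {x : ℝ} (hx : 0 ≤ x) : 0 ≤ f x := by
  obtain ⟨hm, hc, -, -, hpos⟩ := hf
  have h0 : 0 ≤ f 0 := by
    have hcont := (continuousOn_Ici_of_convexOn_of_monotoneOn hc hm 0 self_mem_Ici).mono
      Ioi_subset_Ici_self
    exact ge_of_tendsto hcont (eventually_nhdsWithin_of_forall fun y hy => (hpos y hy).le)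
  exact h0.trans (hm self_mem_Ici hx hx)

/-! ### The energy estimate -/

theorem abs_setIntegral_halfSp_le {n : ℕ} {D : Set (Spc n × ℝ)} (hD : MeasurableSet D)
    (hDs : D ⊆ halfSp n) {F G : Spc n × ℝ → ℝ} (hG : IntegrableOn G D)
    (h0 : ∀ z ∈ halfSp n, z ∉ D → F z = 0)
    (hle : ∀ᵐ z ∂(volume.restrict (halfSp n)), |F z| ≤ G z) :
    |∫ z in halfSp n, F z| ≤ ∫ z in D, G z := by
  have h := norm_integral_le_of_norm_le (μ := volume.restrict (halfSp n)) (f := F)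
    (g := D.indicator G) (((integrable_indicator_iff hD).2 hG).restrict) (by
      filter_upwards [hle, ae_restrict_mem measurableSet_halfSp] with z hz hzH
      by_cases hzD : z ∈ D
      · simpa [hzD] using hz
      · simp [hzD, h0 z hzH hzD])
  rwa [setIntegral_indicator hD, inter_eq_self_of_subset_right hDs] at h

theorem exists_energy_le (n k m : ℕ) (hk : 1 ≤ k) (hm : 1 ≤ m) {A : ℝ} (hA : 0 < A) (p : ℝ)
    {κ : ℝ} (hκ : 0 < κ) :
    ∃ K : ℝ, 0 < K ∧
      ∀ (a : (Fin n → ℕ) → Spc n × ℝ → ℝ → ℝ) (f : ℝ → ℝ) (u0 : ℕ → Spc n → ℝ)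
        (u : Spc n × ℝ → ℝ), Standing n k m A p a f u0 → IsGlobalWeakSol n k m p a f u0 u →
        ∀ R : ℝ, 0 < R →
          ∫ z in cyl n (R / 2) κ, f |u z|
            ≤ K * ((R ^ κ)⁻¹ ^ k * ∫ z in cyl n R κ \ cyl n (R / 2) κ, |u z|)
              + K * (R⁻¹ ^ m * ∫ z in cyl n R κ \ cyl n (R / 2) κ, |u z| ^ p) := by
  obtain ⟨ψ, M, N, hsm, hsupp, hψ0, hψ1, hψone, hψzero, hψt, hM0, hN0, hM, hN, hD0⟩ :=
    exists_cutoff n k m hk hm hκ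
  have hAN : 0 ≤ A * N := mul_nonneg hA.le hN0
  refine ⟨M + A * N + 1, by positivity, fun a f u0 u hst hu R hR => ?_⟩
  obtain ⟨ha, hf, -, hu0, -, -⟩ := hst
  obtain ⟨hint, hintp, hintf, hweak⟩ := hu
  have hRκ : 0 < R ^ κ := rpow_pos_of_pos hR κ
  set φ : Spc n × ℝ → ℝ := fun z => ψ (R⁻¹ • z.1, (R ^ κ)⁻¹ * z.2) with hφ
  set D := cyl n R κ \ cyl n (R / 2) κ
  have hDm : MeasurableSet D := (measurableSet_cyl _).diff (measurableSet_cyl _)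
  have hDs : D ⊆ halfSp n := sdiff_subset.trans (cyl_subset_halfSp R)
  have hmem1 : ∀ z : Spc n × ℝ, (R⁻¹ • z.1, (R ^ κ)⁻¹ * z.2) ∈ cyl n 1 κ ↔ z ∈ cyl n R κ :=
    fun z => by simpa using mem_cyl_scale (κ := κ) hR zero_le_one z
  have hmem2 : ∀ z : Spc n × ℝ,
      (R⁻¹ • z.1, (R ^ κ)⁻¹ * z.2) ∈ cyl n (1 / 2) κ ↔ z ∈ cyl n (R / 2) κ :=
    fun z => by simpa [div_eq_mul_inv] using
      mem_cyl_scale (κ := κ) hR (r := 1 / 2) (by norm_num) z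
  have hmemH : ∀ z ∈ halfSp n, (R⁻¹ • z.1, (R ^ κ)⁻¹ * z.2) ∈ halfSp n :=
    fun z hz => mul_pos (inv_pos.2 hRκ) hz
  have hφsm : ContDiff ℝ (⊤ : ℕ∞) φ :=
    hsm.comp ((contDiff_fst.const_smul _).prodMk (contDiff_const.mul contDiff_snd))
  have hφsupp : HasCompactSupport φ :=
    hsupp.comp_homeomorph ((Homeomorph.smulOfNeZero R⁻¹ (inv_ne_zero hR.ne')).prodCongr
      (Homeomorph.mulLeft₀ (R ^ κ)⁻¹ (inv_ne_zero hRκ.ne')))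
  have hw := hweak φ hφsm hφsupp fun z => hψ0 _
  have hT1 : |∫ z in halfSp n, (-1 : ℝ) ^ k * u z * (tDeriv n)^[k] φ z|
      ≤ ∫ z in D, M * (R ^ κ)⁻¹ ^ k * |u z| := by
    have hder : (tDeriv n)^[k] φ
        = fun z => (R ^ κ)⁻¹ ^ k * (tDeriv n)^[k] ψ (R⁻¹ • z.1, (R ^ κ)⁻¹ * z.2) :=
      iterate_tDeriv_scale _ _ _
    refine abs_setIntegral_halfSp_le hDm hDs
      (((integrableOn_cyl hint hR).mono_set sdiff_subset).abs.const_mul _) ?_ ?_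
    · intro z hz hzD
      rw [hder]
      simp [(hD0 _ (hmemH z hz) (by rwa [Set.mem_sdiff, hmem1, hmem2])).1]
    · refine Eventually.of_forall fun z => ?_
      rw [hder]
      simp only [abs_mul, abs_pow, abs_neg, abs_one, one_pow, one_mul, abs_inv, abs_of_pos hRκ]
      calc |u z| * ((R ^ κ)⁻¹ ^ k * |(tDeriv n)^[k] ψ (R⁻¹ • z.1, (R ^ κ)⁻¹ * z.2)|)
          ≤ |u z| * ((R ^ κ)⁻¹ ^ k * M) := by gcongr; exact hM _
        _ = M * (R ^ κ)⁻¹ ^ k * |u z| := by ring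
  have hT2 : |∫ z in halfSp n, ∑ α ∈ mIdx n m, (-1 : ℝ) ^ m * a α z (u z) * mDeriv n α φ z|
      ≤ ∫ z in D, A * N * R⁻¹ ^ m * |u z| ^ p := by
    have hder : ∀ α ∈ mIdx n m, mDeriv n α φ
        = fun z => R⁻¹ ^ m * mDeriv n α ψ (R⁻¹ • z.1, (R ^ κ)⁻¹ * z.2) :=
      fun α hα => mDeriv_scale hα _ _
    refine abs_setIntegral_halfSp_le hDm hDs
      (((integrableOn_cyl hintp hR).mono_set sdiff_subset).const_mul _) ?_ ?_
    · intro z hz hzD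
      refine Finset.sum_eq_zero fun α hα => ?_
      rw [hder α hα]
      simp [(hD0 _ (hmemH z hz) (by rwa [Set.mem_sdiff, hmem1, hmem2])).2 α hα]
    · have hall : ∀ᵐ z ∂(volume.restrict (halfSp n)), ∀ α ∈ mIdx n m, ∀ ζ : ℝ,
          |a α z ζ| ≤ A * |ζ| ^ p :=
        (Finset.eventually_all _).2 fun α hα => (ha α hα).2.2
      filter_upwards [hall] with z hz
      calc |∑ α ∈ mIdx n m, (-1 : ℝ) ^ m * a α z (u z) * mDeriv n α φ z|
          ≤ ∑ α ∈ mIdx n m, |(-1 : ℝ) ^ m * a α z (u z) * mDeriv n α φ z| :=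
            Finset.abs_sum_le_sum_abs _ _
        _ ≤ ∑ α ∈ mIdx n m, A * |u z| ^ p
              * (R⁻¹ ^ m * |mDeriv n α ψ (R⁻¹ • z.1, (R ^ κ)⁻¹ * z.2)|) := by
            refine Finset.sum_le_sum fun α hα => ?_
            rw [hder α hα]
            simp only [abs_mul, abs_pow, abs_neg, abs_one, one_pow, one_mul, abs_inv,
              abs_of_pos hR]
            gcongr
            exact hz α hα _
        _ = A * |u z| ^ p * R⁻¹ ^ m
              * ∑ α ∈ mIdx n m, |mDeriv n α ψ (R⁻¹ • z.1, (R ^ κ)⁻¹ * z.2)| := by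
            rw [Finset.mul_sum]
            exact Finset.sum_congr rfl fun _ _ => by ring
        _ ≤ A * |u z| ^ p * R⁻¹ ^ m * N := by gcongr; exact hN _
        _ = A * N * R⁻¹ ^ m * |u z| ^ p := by ring
  have hI0 : 0 ≤ ∫ x : Spc n, ∑ i ∈ Finset.range k,
      (-1 : ℝ) ^ i * u0 (k - 1 - i) x * (tDeriv n)^[i] φ (x, 0) := by
    refine integral_nonneg_of_ae ?_
    filter_upwards [hu0] with x hx
    refine Finset.sum_nonneg fun i _ => ?_
    rcases Nat.eq_zero_or_pos i with rfl | hi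
    · simpa using mul_nonneg hx (hψ0 _)
    · rw [hφ, iterate_tDeriv_scale]
      simp [hψt i hi]
  have hfnn : ∀ z, 0 ≤ f |u z| := fun z => hf.nonneg (abs_nonneg _)
  have hF : ∫ z in cyl n (R / 2) κ, f |u z| ≤ ∫ z in halfSp n, f |u z| * φ z := by
    have hfφ : IntegrableOn (fun z => f |u z| * φ z) (cyl n R κ) :=
      (integrableOn_cyl hintf hR).mul_bdd (c := 1) hφsm.continuous.aestronglyMeasurable
        (Eventually.of_forall fun z => by
          rw [Real.norm_eq_abs, abs_of_nonneg (hψ0 _)]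
          exact hψ1 _)
    have hfφ' : IntegrableOn (fun z => f |u z| * φ z) (halfSp n) :=
      hfφ.of_forall_sdiff_eq_zero measurableSet_halfSp fun z hz => by
        simp [hφ, hψzero _ (hmemH z hz.1) (by rw [hmem1]; exact hz.2)]
    calc ∫ z in cyl n (R / 2) κ, f |u z| = ∫ z in cyl n (R / 2) κ, f |u z| * φ z := by
          refine setIntegral_congr_fun (measurableSet_cyl _) fun z hz => ?_
          simp [hφ, hψone _ ((hmem2 z).2 hz)]
      _ ≤ ∫ z in halfSp n, f |u z| * φ z :=
          setIntegral_mono_set hfφ' (Eventually.of_forall fun z => mul_nonneg (hfnn z) (hψ0 _))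
            (cyl_subset_halfSp _).eventuallyLE
  rw [integral_const_mul] at hT1 hT2
  have hX : 0 ≤ (R ^ κ)⁻¹ ^ k * ∫ z in D, |u z| :=
    mul_nonneg (by positivity) (integral_nonneg fun _ => abs_nonneg _)
  have hY : 0 ≤ R⁻¹ ^ m * ∫ z in D, |u z| ^ p :=
    mul_nonneg (by positivity) (integral_nonneg fun _ => rpow_nonneg (abs_nonneg _) _)
  have h1 := (abs_le.1 hT1).2
  have h2 := (abs_le.1 hT2).1
  nlinarith [mul_nonneg hM0 hY, mul_nonneg hAN hX]

/-- **Lemma 3.9.** Let `0 < p < 1` and `E(r) = ∫_{Q_r^κ} f(|u|)`. For every `κ > 0`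
there are `C, σ > 0`, depending only on `A, k, m, n, p, κ`, such that for every global
weak solution `u` and all `R > 0` at least one of the two systems of inequalities of
Lemma 3.9 holds. -/
theorem lemma_3_9
    (n k m : ℕ) (hn : 1 ≤ n) (hk : 1 ≤ k) (hm : 1 ≤ m)
    (A p : ℝ) (hA : 0 < A) (hp0 : 0 < p) (hp1 : p < 1) (κ : ℝ) (hκ : 0 < κ) :
    ∃ C σ : ℝ, 0 < C ∧ 0 < σ ∧
      ∀ (a : (Fin n → ℕ) → Spc n × ℝ → ℝ → ℝ) (f : ℝ → ℝ) (u0 : ℕ → Spc n → ℝ)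
        (u : Spc n × ℝ → ℝ), Standing n k m A p a f u0 →
        IsGlobalWeakSol n k m p a f u0 u →
        ∀ R : ℝ, 0 < R →
        ∀ E : ℝ → ℝ, (∀ r : ℝ, E r = ∫ z in cyl n r κ, f |u z|) →
        ∀ v : ℝ,
          v = (volume (cyl n R κ \ cyl n (R / 2) κ)).toReal⁻¹
              * ∫ z in cyl n R κ \ cyl n (R / 2) κ, |u z| →
          (σ * E (R / 2) / R ^ ((n : ℝ) - ((k : ℝ) - 1) * κ) ≤ v ∧
            C * (R ^ ((n : ℝ) + κ)
                * f (σ * E (R / 2) / R ^ ((n : ℝ) - ((k : ℝ) - 1) * κ)))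
              ≤ E R - E (R / 2)) ∨
          (σ * E (R / 2) / R ^ ((n : ℝ) + κ - (m : ℝ)) ≤ v ^ p ∧
            C * (R ^ ((n : ℝ) + κ)
                * f ((σ * E (R / 2) / R ^ ((n : ℝ) + κ - (m : ℝ))) ^ (1 / p)))
              ≤ E R - E (R / 2)) := by
  obtain ⟨c, hc, hvol⟩ := exists_volume_shell n hκ
  obtain ⟨K, hK, hest⟩ := exists_energy_le n k m hk hm hA p hκ
  refine ⟨c, (2 * K * c)⁻¹, hc, by positivity, ?_⟩
  intro a f u0 u hst hu R hR E hE v hv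
  have hest := hest a f u0 u hst hu R hR
  obtain ⟨-, hf, -⟩ := hst
  obtain ⟨hint, hintp, hintf, -⟩ := hu
  have hsub : cyl n (R / 2) κ ⊆ cyl n R κ := cyl_mono hκ (by positivity) (by linarith)
  rw [← hE] at hest
  set D := cyl n R κ \ cyl n (R / 2) κ
  set W := (volume D).toReal with hWdef
  have hW : W = c * R ^ ((n : ℝ) + κ) := hvol R hR
  have hW0 : 0 < W := by rw [hW]; positivity
  have hDne : volume D ≠ 0 := fun h => hW0.ne' (by simp [hWdef, h])
  have hDtop : volume D ≠ ⊤ := ((measure_mono sdiff_subset).trans_lt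
    (volume_cyl_ne_top hR).lt_top).ne
  have havg : ∀ g : Spc n × ℝ → ℝ, ⨍ z in D, g z = W⁻¹ * ∫ z in D, g z := fun g => by
    rw [setAverage_eq, measureReal_def, smul_eq_mul]
  have hintD := ((integrableOn_cyl (κ := κ) hint hR).mono_set (sdiff_subset : D ⊆ _)).abs
  have hintpD := (integrableOn_cyl (κ := κ) hintp hR).mono_set (sdiff_subset : D ⊆ _)
  have hintfD := (integrableOn_cyl (κ := κ) hintf hR).mono_set (sdiff_subset : D ⊆ _)
  have hIci : ∀ᵐ z ∂volume.restrict D, |u z| ∈ Ici (0 : ℝ) :=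
    Eventually.of_forall fun z => mem_Ici.2 (abs_nonneg _)
  have hv0 : 0 ≤ v := by
    rw [hv]
    exact mul_nonneg (inv_nonneg.2 hW0.le) (integral_nonneg fun _ => abs_nonneg _)
  have hdiff : E R - E (R / 2) = ∫ z in D, f |u z| := by
    rw [hE, hE, setIntegral_sdiff (measurableSet_cyl _) (integrableOn_cyl hintf hR) hsub]
  have hJf : c * (R ^ ((n : ℝ) + κ) * f v) ≤ E R - E (R / 2) := by
    have h := hf.2.1.map_set_average_le
      (continuousOn_Ici_of_convexOn_of_monotoneOn hf.2.1 hf.1) isClosed_Ici hDne hDtop hIci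
      hintD hintfD
    rw [havg, havg, ← hv, le_inv_mul_iff₀ hW0] at h
    rwa [hdiff, ← mul_assoc, ← hW]
  have hJp : ∫ z in D, |u z| ^ p ≤ W * v ^ p := by
    have h := (Real.concaveOn_rpow hp0.le hp1.le).le_map_set_average
      (continuous_id.rpow_const fun _ => Or.inr hp0.le).continuousOn isClosed_Ici hDne hDtop hIci
      hintD hintpD
    rw [havg, havg, ← hv, inv_mul_le_iff₀ hW0] at h
    exact h
  have hEnn : 0 ≤ E (R / 2) := by
    rw [hE]
    exact integral_nonneg fun z => hf.nonneg (abs_nonneg _)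
  have hIu : ∫ z in D, |u z| = W * v := by
    rw [hv, mul_inv_cancel_left₀ hW0.ne']
  have hpow1 : (R ^ κ)⁻¹ ^ k * (W * v) = c * (R ^ ((n : ℝ) - ((k : ℝ) - 1) * κ) * v) := by
    have : (n : ℝ) - ((k : ℝ) - 1) * κ = -κ * k + (n + κ) := by ring
    rw [hW, this, rpow_add hR (-κ * k), rpow_mul_natCast hR.le, rpow_neg hR.le]
    ring
  have hpow2 : R⁻¹ ^ m * (W * v ^ p) = c * (R ^ ((n : ℝ) + κ - (m : ℝ)) * v ^ p) := by
    rw [hW, rpow_sub hR _ (m : ℝ), rpow_natCast, inv_pow]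
    ring
  have hest' : E (R / 2) ≤ K * (c * (R ^ ((n : ℝ) - ((k : ℝ) - 1) * κ) * v))
      + K * (c * (R ^ ((n : ℝ) + κ - (m : ℝ)) * v ^ p)) := by
    rw [← hpow1, ← hpow2, ← hIu]
    refine hest.trans ?_
    gcongr
  have hσ : ∀ {X y : ℝ}, 0 < X → E (R / 2) / 2 ≤ K * (c * (X * y)) →
      (2 * K * c)⁻¹ * E (R / 2) / X ≤ y := by
    intro X y hX h
    rw [div_le_iff₀ hX, inv_mul_le_iff₀ (by positivity)]
    linarith
  have hmono : ∀ {x : ℝ}, 0 ≤ x → x ≤ v →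
      c * (R ^ ((n : ℝ) + κ) * f x) ≤ E R - E (R / 2) := by
    intro x hx hxv
    refine le_trans ?_ hJf
    gcongr
    exact hf.1 hx hv0 hxv
  rcases le_or_gt (E (R / 2) / 2) (K * (c * (R ^ ((n : ℝ) - ((k : ℝ) - 1) * κ) * v)))
    with h | h
  · have hle := hσ (rpow_pos_of_pos hR _) h
    exact Or.inl ⟨hle, hmono (by positivity) hle⟩
  · have hle := hσ (X := R ^ ((n : ℝ) + κ - (m : ℝ))) (y := v ^ p)
      (rpow_pos_of_pos hR _) (by linarith)
    refine Or.inr ⟨hle, hmono (by positivity) ?_⟩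
    rw [one_div]
    exact (rpow_inv_le_iff_of_pos (by positivity) hv0 hp0).2 hle
end
end

section
/- Let k ≥ 1 be an integer and let f : [0,∞) → ℝ be nondecreasing and convex with f(ζ) > 0 for all ζ > 0. If ∫_1^∞ ζ^{1/k−1} f(ζ)^{−1/k} dζ = ∞, then for every w_0 > 0 the Cauchy problem w^{(k)}(r) = f(w(r)), w(0) = w_0, w^{(i)}(0) = 0 for i = 1, …, k−1, has a solution w of class C^k defined on the whole interval [0, ∞). -/
open MeasureTheory Real Set

open Filter Topology

/-- The primitive of `g` vanishing at the origin. -/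
noncomputable def primitiveZero (g : ℝ → ℝ) : ℝ → ℝ := fun r => ∫ s in (0 : ℝ)..r, g s

@[simp]
theorem primitiveZero_zero (g : ℝ → ℝ) : primitiveZero g 0 = 0 := by
  simp [primitiveZero]

theorem hasDerivAt_primitiveZero {g : ℝ → ℝ} (hg : Continuous g) (r : ℝ) :
    HasDerivAt (primitiveZero g) (g r) r :=
  intervalIntegral.integral_hasDerivAt_right (hg.intervalIntegrable _ _)
    (hg.stronglyMeasurableAtFilter _ _) hg.continuousAt

theorem deriv_primitiveZero {g : ℝ → ℝ} (hg : Continuous g) : deriv (primitiveZero g) = g :=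
  funext fun r => (hasDerivAt_primitiveZero hg r).deriv

theorem continuous_primitiveZero {g : ℝ → ℝ} (hg : Continuous g) : Continuous (primitiveZero g) :=
  continuous_iff_continuousAt.2 fun r => (hasDerivAt_primitiveZero hg r).continuousAt

theorem continuous_iterate_primitiveZero {g : ℝ → ℝ} (hg : Continuous g) (m : ℕ) :
    Continuous (primitiveZero^[m] g) := by
  induction m with
  | zero => exact hg
  | succ m ih => rw [Function.iterate_succ_apply']; exact continuous_primitiveZero ih

theorem contDiff_iterate_primitiveZero {g : ℝ → ℝ} (hg : Continuous g) (m : ℕ) :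
    ContDiff ℝ m (primitiveZero^[m] g) := by
  induction m with
  | zero => simpa using hg
  | succ m ih =>
    have hc := continuous_iterate_primitiveZero hg m
    rw [Function.iterate_succ_apply', Nat.cast_add, Nat.cast_one, contDiff_succ_iff_deriv,
      deriv_primitiveZero hc]
    exact ⟨fun r => (hasDerivAt_primitiveZero hc r).differentiableAt, by simp, ih⟩

theorem iteratedDeriv_iterate_primitiveZero {g : ℝ → ℝ} (hg : Continuous g) (i m : ℕ) :
    iteratedDeriv i (primitiveZero^[m + i] g) = primitiveZero^[m] g := by
  induction i with
  | zero => simp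
  | succ i ih =>
    rw [iteratedDeriv_succ', ← add_assoc, Function.iterate_succ_apply',
      deriv_primitiveZero (continuous_iterate_primitiveZero hg _), ih]

theorem primitiveZero_le_primitiveZero {g h : ℝ → ℝ} (hg : Continuous g) (hh : Continuous h)
    (hgh : ∀ s, 0 ≤ s → g s ≤ h s) {r : ℝ} (hr : 0 ≤ r) :
    primitiveZero g r ≤ primitiveZero h r :=
  intervalIntegral.integral_mono_on hr (hg.intervalIntegrable _ _) (hh.intervalIntegrable _ _)
    fun s hs => hgh s hs.1

theorem iterate_primitiveZero_le {g h : ℝ → ℝ} (hg : Continuous g) (hh : Continuous h)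
    (hgh : ∀ s, 0 ≤ s → g s ≤ h s) (m : ℕ) :
    ∀ r, 0 ≤ r → primitiveZero^[m] g r ≤ primitiveZero^[m] h r := by
  induction m with
  | zero => exact hgh
  | succ m ih =>
    intro r hr
    simp only [Function.iterate_succ_apply']
    exact primitiveZero_le_primitiveZero (continuous_iterate_primitiveZero hg m)
      (continuous_iterate_primitiveZero hh m) ih hr

theorem iterate_primitiveZero_nonneg {g : ℝ → ℝ} (hg0 : ∀ s, 0 ≤ s → 0 ≤ g s) (m : ℕ) :
    ∀ r, 0 ≤ r → 0 ≤ primitiveZero^[m] g r := by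
  induction m with
  | zero => exact hg0
  | succ m ih =>
    intro r hr
    rw [Function.iterate_succ_apply']
    exact intervalIntegral.integral_nonneg hr fun s hs => ih s hs.1

theorem monotoneOn_primitiveZero {g : ℝ → ℝ} (hg : Continuous g)
    (hg0 : ∀ s, 0 ≤ s → 0 ≤ g s) : MonotoneOn (primitiveZero g) (Ici 0) := by
  refine monotoneOn_of_deriv_nonneg (convex_Ici 0) (continuous_primitiveZero hg).continuousOn
    (fun r _ => (hasDerivAt_primitiveZero hg r).differentiableAt.differentiableWithinAt) ?_
  intro r hr
  rw [interior_Ici] at hr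
  rw [deriv_primitiveZero hg]
  exact hg0 r hr.le

theorem monotoneOn_iterate_primitiveZero {g : ℝ → ℝ} (hg : Continuous g)
    (hg0 : ∀ s, 0 ≤ s → 0 ≤ g s) (hgm : MonotoneOn g (Ici 0)) (m : ℕ) :
    MonotoneOn (primitiveZero^[m] g) (Ici 0) := by
  cases m with
  | zero => exact hgm
  | succ m =>
    rw [Function.iterate_succ_apply']
    exact monotoneOn_primitiveZero (continuous_iterate_primitiveZero hg m)
      (iterate_primitiveZero_nonneg hg0 m)

theorem sq_primitiveZero_le {g : ℝ → ℝ} (hg : Continuous g)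
    (hg0 : ∀ s, 0 ≤ s → 0 ≤ g s) (hgm : MonotoneOn g (Ici 0)) {r : ℝ} (hr : 0 ≤ r) :
    primitiveZero g r ^ 2 ≤ 2 * primitiveZero (primitiveZero g) r * g r := by
  have hc := continuous_primitiveZero hg
  have hd : ∀ s, HasDerivAt
      (fun s => 2 * primitiveZero (primitiveZero g) s * g r - primitiveZero g s ^ 2)
      (2 * primitiveZero g s * (g r - g s)) s := by
    intro s
    refine (((hasDerivAt_primitiveZero hc s).const_mul 2).mul_const (g r) |>.sub
      ((hasDerivAt_primitiveZero hg s).pow 2)).congr_deriv ?_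
    norm_num
    ring
  have hm : MonotoneOn
      (fun s => 2 * primitiveZero (primitiveZero g) s * g r - primitiveZero g s ^ 2)
      (Icc 0 r) := by
    refine monotoneOn_of_deriv_nonneg (convex_Icc 0 r)
      (fun s _ => (hd s).continuousAt.continuousWithinAt)
      (fun s _ => (hd s).differentiableAt.differentiableWithinAt) ?_
    intro s hs
    rw [interior_Icc] at hs
    rw [(hd s).deriv]
    exact mul_nonneg (mul_nonneg zero_le_two
      (iterate_primitiveZero_nonneg hg0 1 s hs.1.le)) (sub_nonneg.2 (hgm hs.1.le hr hs.2.le))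
  have := hm (left_mem_Icc.2 hr) (right_mem_Icc.2 hr) hr
  simp at this
  linarith

/-- A Landau–Kolmogorov type inequality for iterated primitives of a nondecreasing function. -/
theorem exists_iterate_primitiveZero_pow_le (m : ℕ) :
    ∃ C : ℝ, 0 < C ∧ ∀ g : ℝ → ℝ, Continuous g → (∀ s, 0 ≤ s → 0 ≤ g s) →
      MonotoneOn g (Ici 0) → ∀ r, 0 ≤ r →
      primitiveZero^[m] g r ^ (m + 1) ≤ C * primitiveZero^[m + 1] g r ^ m * g r := by
  induction m with
  | zero => exact ⟨1, one_pos, fun g _ _ _ r _ => by simp⟩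
  | succ m ih =>
    obtain ⟨C, hC, h⟩ := ih
    refine ⟨2 ^ (m + 1) * C, by positivity, fun g hg hg0 hgm r hr => ?_⟩
    have h1 := h g hg hg0 hgm r hr
    have h2 := sq_primitiveZero_le (continuous_iterate_primitiveZero hg m)
      (iterate_primitiveZero_nonneg hg0 m) (monotoneOn_iterate_primitiveZero hg hg0 hgm m) hr
    simp only [← Function.iterate_succ_apply' primitiveZero] at h2
    have ha := iterate_primitiveZero_nonneg hg0 m r hr
    have hb := iterate_primitiveZero_nonneg hg0 (m + 1) r hr
    have hc := iterate_primitiveZero_nonneg hg0 (m + 1 + 1) r hr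
    have hd := hg0 r hr
    simp only [Nat.succ_eq_add_one] at h2
    generalize primitiveZero^[m] g r = a at *
    generalize primitiveZero^[m + 1] g r = b at *
    generalize primitiveZero^[m + 1 + 1] g r = c at *
    rcases hb.eq_or_lt with rfl | hb
    · rw [zero_pow (by omega)]
      positivity
    · refine le_of_mul_le_mul_left ?_ (pow_pos hb m)
      calc b ^ m * b ^ (m + 1 + 1) = (b ^ 2) ^ (m + 1) := by ring
        _ ≤ (2 * c * a) ^ (m + 1) := by gcongr
        _ = 2 ^ (m + 1) * c ^ (m + 1) * a ^ (m + 1) := by rw [mul_pow, mul_pow]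
        _ ≤ 2 ^ (m + 1) * c ^ (m + 1) * (C * b ^ m * g r) := by gcongr
        _ = b ^ m * (2 ^ (m + 1) * C * c ^ (m + 1) * g r) := by ring

theorem tendsto_iterate_primitiveZero {g : ℕ → ℝ → ℝ} {G : ℝ → ℝ} (hg : ∀ n, Continuous (g n))
    (hb : ∀ r, 0 ≤ r → ∃ M, ∀ n, ∀ s ∈ Icc 0 r, |g n s| ≤ M)
    (hlim : ∀ r, 0 ≤ r → Tendsto (fun n => g n r) atTop (𝓝 (G r))) (m : ℕ) :
    (∀ r, 0 ≤ r → ∃ M, ∀ n, ∀ s ∈ Icc 0 r, |primitiveZero^[m] (g n) s| ≤ M) ∧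
      ∀ r, 0 ≤ r →
        Tendsto (fun n => primitiveZero^[m] (g n) r) atTop (𝓝 (primitiveZero^[m] G r)) := by
  induction m with
  | zero => exact ⟨hb, hlim⟩
  | succ m ih =>
    simp only [Function.iterate_succ_apply']
    refine ⟨fun r hr => ?_, fun r hr => ?_⟩
    · obtain ⟨M, hM⟩ := ih.1 r hr
      have hM0 : 0 ≤ M := (abs_nonneg _).trans (hM 0 0 (left_mem_Icc.2 hr))
      refine ⟨M * r, fun n s hs => ?_⟩
      have := intervalIntegral.norm_integral_le_of_norm_le_const (a := 0) (b := s) (C := M)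
        (f := primitiveZero^[m] (g n)) fun x hx => by
          rw [uIoc_of_le hs.1] at hx
          exact hM n x ⟨hx.1.le, hx.2.trans hs.2⟩
      rw [sub_zero, abs_of_nonneg hs.1, Real.norm_eq_abs] at this
      exact this.trans (mul_le_mul_of_nonneg_left hs.2 hM0)
    · obtain ⟨M, hM⟩ := ih.1 r hr
      refine intervalIntegral.tendsto_integral_filter_of_dominated_convergence (fun _ => M)
        (Eventually.of_forall fun n =>
          (continuous_iterate_primitiveZero (hg n) m).aestronglyMeasurable)
        (Eventually.of_forall fun n => ae_of_all _ fun x hx => ?_) (by simp)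
        (ae_of_all _ fun x hx => ?_)
      · rw [uIoc_of_le hr] at hx
        exact hM n x ⟨hx.1.le, hx.2⟩
      · rw [uIoc_of_le hr] at hx
        exact ih.2 x hx.1.le

/-- Picard iterates for `w^{(k)} = F(w)` with data `w(0) = w₀`, `w^{(i)}(0) = 0`. -/
noncomputable def picardIterate (k : ℕ) (F : ℝ → ℝ) (w₀ : ℝ) : ℕ → ℝ → ℝ
  | 0 => fun _ => w₀
  | n + 1 => fun r => w₀ + primitiveZero^[k] (F ∘ picardIterate k F w₀ n) r

section Picard

variable {k : ℕ} {F : ℝ → ℝ} {w₀ : ℝ}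

theorem continuous_picardIterate (hF : Continuous F) (n : ℕ) :
    Continuous (picardIterate k F w₀ n) := by
  induction n with
  | zero => exact continuous_const
  | succ n ih => exact continuous_const.add (continuous_iterate_primitiveZero (hF.comp ih) k)

theorem le_picardIterate (hF0 : ∀ x, 0 ≤ F x) (n : ℕ) {r : ℝ} (hr : 0 ≤ r) :
    w₀ ≤ picardIterate k F w₀ n r := by
  cases n with
  | zero => exact le_rfl
  | succ n => exact le_add_of_nonneg_right (iterate_primitiveZero_nonneg (fun s _ => hF0 _) k r hr)

theorem monotoneOn_picardIterate (hF : Continuous F) (hFm : Monotone F) (hF0 : ∀ x, 0 ≤ F x)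
    (n : ℕ) : MonotoneOn (picardIterate k F w₀ n) (Ici 0) := by
  induction n with
  | zero => exact monotoneOn_const
  | succ n ih =>
    exact monotoneOn_const.add (monotoneOn_iterate_primitiveZero
      (hF.comp (continuous_picardIterate hF n)) (fun s _ => hF0 _) (hFm.comp_monotoneOn ih) k)

theorem picardIterate_le_succ (hF : Continuous F) (hFm : Monotone F) (hF0 : ∀ x, 0 ≤ F x)
    (n : ℕ) : ∀ r, 0 ≤ r → picardIterate k F w₀ n r ≤ picardIterate k F w₀ (n + 1) r := by
  induction n with
  | zero => exact fun r hr => le_picardIterate hF0 1 hr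
  | succ n ih =>
    intro r hr
    exact add_le_add le_rfl (iterate_primitiveZero_le (hF.comp (continuous_picardIterate hF n))
      (hF.comp (continuous_picardIterate hF (n + 1))) (fun s hs => hFm (ih s hs)) k r hr)

theorem exists_picardIterate_le (hk : 1 ≤ k) (hF : Continuous F) (hFm : Monotone F)
    (hF0 : ∀ x, 0 < F x) (hw₀ : 0 < w₀)
    (hdiv : ¬ IntegrableOn (fun x : ℝ => x ^ ((k : ℝ)⁻¹ - 1) / F x ^ ((k : ℝ)⁻¹)) (Ioi w₀))
    {r : ℝ} (hr : 0 ≤ r) : ∃ B, ∀ n, picardIterate k F w₀ n r ≤ B := by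
  obtain ⟨m, rfl⟩ : ∃ m, k = m + 1 := ⟨k - 1, by omega⟩
  obtain ⟨C, hC, hCb⟩ := exists_iterate_primitiveZero_pow_le m
  set p : ℝ := ((m + 1 : ℕ) : ℝ)⁻¹ with hp
  have hp0 : 0 < p := by positivity
  set H : ℝ → ℝ := fun x => (max x w₀) ^ (p - 1) / F x ^ p with hH
  have hmax : ∀ x, 0 < max x w₀ := fun x => lt_max_of_lt_right hw₀
  have hHc : Continuous H := by
    refine Continuous.div ?_ ?_ fun x => (rpow_pos_of_pos (hF0 x) p).ne'
    · exact (continuous_id.max continuous_const).rpow_const fun x => Or.inl (hmax x).ne'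
    · exact hF.rpow_const fun x => Or.inl (hF0 x).ne'
  have hHpos : ∀ x, 0 < H x := fun x =>
    div_pos (rpow_pos_of_pos (hmax x) _) (rpow_pos_of_pos (hF0 x) _)
  have hGd : ∀ x, HasDerivAt (fun x => ∫ t in w₀..x, H t) (H x) x := fun x =>
    intervalIntegral.integral_hasDerivAt_right (hHc.intervalIntegrable _ _)
      (hHc.stronglyMeasurableAtFilter _ _) hHc.continuousAt
  have hGm : StrictMono fun x => ∫ t in w₀..x, H t :=
    strictMono_of_deriv_pos fun x => by rw [(hGd x).deriv]; exact hHpos x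
  have hGn : ∀ n, (∫ t in w₀..picardIterate (m + 1) F w₀ (n + 1) r, H t) ≤ C ^ p * r := by
    intro n
    set u := picardIterate (m + 1) F w₀ (n + 1) with hu
    set g := F ∘ picardIterate (m + 1) F w₀ n with hg
    have hgc : Continuous g := hF.comp (continuous_picardIterate hF n)
    have hg0 : ∀ s, 0 ≤ s → 0 ≤ g s := fun s _ => (hF0 _).le
    have hgm : MonotoneOn g (Ici 0) :=
      hFm.comp_monotoneOn (monotoneOn_picardIterate hF hFm (fun x => (hF0 x).le) n)
    have hud : ∀ s, HasDerivAt u (primitiveZero^[m] g s) s := by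
      intro s
      have := (hasDerivAt_primitiveZero (continuous_iterate_primitiveZero hgc m) s).const_add w₀
      rwa [← Function.iterate_succ_apply' primitiveZero] at this
    have hHu : ∀ s, 0 ≤ s → H (u s) * primitiveZero^[m] g s ≤ C ^ p := by
      intro s hs
      have hus : w₀ ≤ u s := le_picardIterate (fun x => (hF0 x).le) (n + 1) hs
      have hus0 : 0 < u s := hw₀.trans_le hus
      have hq := iterate_primitiveZero_nonneg hg0 m s hs
      have h1 : primitiveZero^[m] g s ^ (m + 1) ≤ C * u s ^ m * F (u s) := by
        refine (hCb g hgc hg0 hgm s hs).trans ?_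
        have h2 : primitiveZero^[m + 1] g s ≤ u s := le_add_of_nonneg_left hw₀.le
        have h3 : g s ≤ F (u s) :=
          hFm (picardIterate_le_succ hF hFm (fun x => (hF0 x).le) n s hs)
        have h4 := iterate_primitiveZero_nonneg hg0 (m + 1) s hs
        have h5 := hg0 s hs
        gcongr
      have h2 : primitiveZero^[m] g s ≤ C ^ p * (u s ^ (m * p)) * F (u s) ^ p := by
        have h3 := rpow_le_rpow (pow_nonneg hq _) h1 hp0.le
        rw [hp, pow_rpow_inv_natCast hq (by omega), ← hp,
          mul_rpow (by positivity) (hF0 _).le, mul_rpow hC.le (by positivity),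
          ← rpow_natCast (u s) m, ← rpow_mul hus0.le] at h3
        exact h3
      have h3 : p - 1 + m * p = 0 := by
        have : ((m : ℝ) + 1) * p = 1 := by
          rw [hp]; push_cast; exact mul_inv_cancel₀ (by positivity)
        linarith
      calc H (u s) * primitiveZero^[m] g s
          ≤ H (u s) * (C ^ p * (u s ^ (m * p)) * F (u s) ^ p) :=
            mul_le_mul_of_nonneg_left h2 (hHpos _).le
        _ = C ^ p * (u s ^ (p - 1) * u s ^ (m * p)) := by
            have := (rpow_pos_of_pos (hF0 (u s)) p).ne'
            simp only [hH, max_eq_left hus]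
            field_simp
        _ = C ^ p := by rw [← rpow_add hus0, h3, rpow_zero, mul_one]
    have hcomp : ∀ s, HasDerivAt (fun s => C ^ p * s - ∫ t in w₀..u s, H t)
        (C ^ p - H (u s) * primitiveZero^[m] g s) s := fun s => by
      have h1 := HasDerivAt.comp s (hGd (u s)) (hud s)
      have h2 := ((hasDerivAt_id s).const_mul (C ^ p)).sub h1
      rw [mul_one] at h2
      exact h2
    have hmono : MonotoneOn (fun s => C ^ p * s - ∫ t in w₀..u s, H t) (Ici 0) := by
      refine monotoneOn_of_deriv_nonneg (convex_Ici 0)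
        (fun s _ => (hcomp s).continuousAt.continuousWithinAt)
        (fun s _ => (hcomp s).differentiableAt.differentiableWithinAt) fun s hs => ?_
      rw [interior_Ici] at hs
      rw [(hcomp s).deriv]
      exact sub_nonneg.2 (hHu s hs.le)
    have hu0 : u 0 = w₀ := by
      simp [hu, picardIterate, Function.iterate_succ_apply']
    have := hmono self_mem_Ici hr hr
    simp only [hu0, intervalIntegral.integral_same] at this
    linarith
  obtain ⟨B, hB⟩ : ∃ B, C ^ p * r < ∫ t in w₀..B, H t := by
    by_contra! hcon
    refine hdiv ?_
    have hint : IntegrableOn H (Ioi w₀) := by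
      refine integrableOn_Ioi_of_intervalIntegral_norm_bounded (C ^ p * r) w₀ (l := atTop)
        (b := id) (fun x => (hHc.integrableOn_Icc).mono_set Ioc_subset_Icc_self) tendsto_id
        (Eventually.of_forall fun x => ?_)
      simp only [Real.norm_eq_abs, abs_of_pos (hHpos _)]
      exact hcon x
    refine hint.congr_fun (fun x hx => ?_) measurableSet_Ioi
    simp only [hH, max_eq_left (mem_Ioi.1 hx).le]
  refine ⟨B, fun n => ?_⟩
  refine (picardIterate_le_succ hF hFm (fun x => (hF0 x).le) n r hr).trans ?_
  exact (hGm.lt_iff_lt.1 ((hGn n).trans_lt hB)).le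

/-- If the Picard iterates are locally bounded, they converge to a solution of the integral
equation. -/
theorem exists_continuous_eq_add_iterate_primitiveZero (hk : 1 ≤ k) (hF : Continuous F)
    (hFm : Monotone F) (hF0 : ∀ x, 0 ≤ F x)
    (hb : ∀ r, 0 ≤ r → ∃ B, ∀ n, picardIterate k F w₀ n r ≤ B) :
    ∃ v : ℝ → ℝ, Continuous v ∧ ∀ r, 0 ≤ r →
      w₀ ≤ v r ∧ v r = w₀ + primitiveZero^[k] (F ∘ v) r := by
  have hbdd : ∀ r, BddAbove (range fun n => picardIterate k F w₀ n (max r 0)) := fun r => by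
    obtain ⟨B, hB⟩ := hb (max r 0) (le_max_right _ _)
    exact ⟨B, forall_mem_range.2 hB⟩
  set v : ℝ → ℝ := fun r => ⨆ n, picardIterate k F w₀ n (max r 0) with hv
  have hvm : Monotone v := fun r s hrs => ciSup_mono (hbdd s) fun n =>
    monotoneOn_picardIterate hF hFm hF0 n (mem_Ici.2 (le_max_right _ _))
      (mem_Ici.2 (le_max_right _ _))
      (max_le_max hrs le_rfl)
  have hlim : ∀ r, 0 ≤ r → Tendsto (fun n => picardIterate k F w₀ n r) atTop (𝓝 (v r)) := by
    intro r hr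
    have := tendsto_atTop_ciSup (monotone_nat_of_le_succ fun n =>
      picardIterate_le_succ (k := k) (w₀ := w₀) hF hFm hF0 n (max r 0) (le_max_right _ _)) (hbdd r)
    simpa only [hv, max_eq_left hr] using this
  have hbF : ∀ r, 0 ≤ r → ∃ M, ∀ n, ∀ s ∈ Icc 0 r, |(F ∘ picardIterate k F w₀ n) s| ≤ M := by
    intro r hr
    obtain ⟨B, hB⟩ := hb r hr
    refine ⟨F B, fun n s hs => ?_⟩
    rw [Function.comp_apply, abs_of_nonneg (hF0 _)]
    exact hFm ((monotoneOn_picardIterate hF hFm hF0 n hs.1 hr hs.2).trans (hB n))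
  have heq : ∀ r, 0 ≤ r → v r = w₀ + primitiveZero^[k] (F ∘ v) r := by
    intro r hr
    refine tendsto_nhds_unique ((tendsto_add_atTop_iff_nat 1).2 (hlim r hr)) ?_
    exact ((tendsto_iterate_primitiveZero (fun n => hF.comp (continuous_picardIterate hF n)) hbF
      (fun s hs => (hF.tendsto _).comp (hlim s hs)) k).2 r hr).const_add w₀
  have hcont : Continuous (primitiveZero^[k] (F ∘ v)) := by
    obtain ⟨m, rfl⟩ : ∃ m, k = m + 1 := ⟨k - 1, by omega⟩
    rw [Function.iterate_succ_apply]
    exact continuous_iterate_primitiveZero (intervalIntegral.continuous_primitive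
      (fun a b => (hFm.comp hvm).intervalIntegrable) 0) m
  refine ⟨v, ?_, fun r hr => ⟨?_, heq r hr⟩⟩
  · have : v = fun r => w₀ + primitiveZero^[k] (F ∘ v) (max r 0) := by
      funext r
      rw [← heq _ (le_max_right _ _)]
      simp [hv]
    rw [this]
    exact continuous_const.add (hcont.comp (continuous_id.max continuous_const))
  · exact ge_of_tendsto' (hlim r hr) fun n => le_picardIterate hF0 n hr

end Picard

/-- **Remark 2.1, first part (Kiguradze–Kvinikadze).** If
`∫_1^∞ ζ^{1/k - 1} f(ζ)^{-1/k} dζ = ∞`, then for every `w₀ > 0` the Cauchy problem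
`w^{(k)}(r) = f(w(r))`, `w(0) = w₀`, `w^{(i)}(0) = 0` for `i = 1, …, k-1`, has a
`C^k` solution defined on the whole interval `[0, ∞)`. -/
theorem global_solution_of_ode_when_condition_1_4_fails
    (k : ℕ) (hk : 1 ≤ k)
    (f : ℝ → ℝ) (hf_mono : MonotoneOn f (Ici 0)) (hf_conv : ConvexOn ℝ (Ici 0) f)
    (hf_pos : ∀ ζ : ℝ, 0 < ζ → 0 < f ζ)
    (hdiv : ¬ IntegrableOn (fun ζ : ℝ => ζ ^ ((k : ℝ)⁻¹ - 1) / f ζ ^ ((k : ℝ)⁻¹)) (Ioi 1))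
    (w₀ : ℝ) (hw₀ : 0 < w₀) :
    ∃ w : ℝ → ℝ, ContDiffOn ℝ k w (Ici 0) ∧ w 0 = w₀ ∧
      (∀ i : ℕ, 1 ≤ i → i < k → iteratedDerivWithin i w (Ici 0) 0 = 0) ∧
      ∀ r ∈ Ici (0 : ℝ), iteratedDerivWithin k w (Ici 0) r = f (w r) := by
  have hfc : ContinuousOn f (Ioi 0) := by
    have := hf_conv.continuousOn_interior
    rwa [interior_Ici] at this
  have hmax : ∀ x, 0 < max x w₀ := fun x => lt_max_of_lt_right hw₀
  set F : ℝ → ℝ := fun x => f (max x w₀) with hFdef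
  have hF : Continuous F :=
    hfc.comp_continuous (continuous_id.max continuous_const) fun x => hmax x
  have hFm : Monotone F := fun x y hxy =>
    hf_mono (hmax x).le (hmax y).le (max_le_max hxy le_rfl)
  have hF0 : ∀ x, 0 < F x := fun x => hf_pos _ (hmax x)
  have hdivF :
      ¬ IntegrableOn (fun x : ℝ => x ^ ((k : ℝ)⁻¹ - 1) / F x ^ ((k : ℝ)⁻¹)) (Ioi w₀) := by
    intro hint
    refine hdiv ?_
    have h1 : IntegrableOn (fun ζ : ℝ => ζ ^ ((k : ℝ)⁻¹ - 1) / f ζ ^ ((k : ℝ)⁻¹)) (Ioi w₀) := by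
      refine hint.congr_fun (fun x hx => ?_) measurableSet_Ioi
      simp only [hFdef, max_eq_left (mem_Ioi.1 hx).le]
    have h2 : IntegrableOn (fun ζ : ℝ => ζ ^ ((k : ℝ)⁻¹ - 1) / f ζ ^ ((k : ℝ)⁻¹)) (Icc 1 w₀) := by
      have hpos : ∀ x ∈ Icc 1 w₀, 0 < x := fun x hx => one_pos.trans_le hx.1
      refine ContinuousOn.integrableOn_Icc (ContinuousOn.div ?_ ?_ fun x hx =>
        (rpow_pos_of_pos (hf_pos x (hpos x hx)) _).ne')
      · exact continuousOn_id.rpow_const fun x hx => Or.inl (hpos x hx).ne'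
      · exact (hfc.mono hpos).rpow_const fun x hx => Or.inl (hf_pos x (hpos x hx)).ne'
    refine (h2.union h1).mono_set fun x hx => ?_
    rcases le_or_gt x w₀ with h | h
    · exact Or.inl ⟨le_of_lt hx, h⟩
    · exact Or.inr h
  obtain ⟨v, hvc, hv⟩ := exists_continuous_eq_add_iterate_primitiveZero hk hF hFm
    (fun x => (hF0 x).le) fun r hr => exists_picardIterate_le hk hF hFm hF0 hw₀ hdivF hr
  have hgc : Continuous (F ∘ v) := hF.comp hvc
  have hcd : ContDiff ℝ k fun r => w₀ + primitiveZero^[k] (F ∘ v) r :=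
    contDiff_const.add (contDiff_iterate_primitiveZero hgc k)
  have hder : ∀ i, 1 ≤ i → i ≤ k → ∀ r ∈ Ici (0 : ℝ),
      iteratedDerivWithin i (fun r => w₀ + primitiveZero^[k] (F ∘ v) r) (Ici 0) r =
        primitiveZero^[k - i] (F ∘ v) r := by
    intro i hi hik r hr
    rw [iteratedDerivWithin_eq_iteratedDeriv (uniqueDiffOn_Ici 0)
      (hcd.contDiffAt.of_le (by exact_mod_cast hik)) hr, iteratedDeriv_const_add (by omega)]
    obtain ⟨j, rfl⟩ := Nat.exists_eq_add_of_le' hik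
    rw [iteratedDeriv_iterate_primitiveZero hgc, Nat.add_sub_cancel]
  refine ⟨fun r => w₀ + primitiveZero^[k] (F ∘ v) r, hcd.contDiffOn, ?_, ?_, ?_⟩
  · obtain ⟨m, rfl⟩ := Nat.exists_eq_add_of_le' hk
    simp [Function.iterate_succ_apply']
  · intro i hi hik
    rw [hder i hi hik.le 0 self_mem_Ici]
    obtain ⟨m, hm⟩ := Nat.exists_eq_add_of_lt hik
    rw [show k - i = m + 1 by omega, Function.iterate_succ_apply', primitiveZero_zero]
  · intro r hr
    beta_reduce
    rw [hder k hk le_rfl r hr, ← (hv r hr).2]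
    simp [hFdef, max_eq_left (hv r hr).1]
end
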